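/- arXiv:2306.10618 — 7 statements merged into one kernel-verified Lean document; each statement's English description precedes it below -/
import Mathlib

section
/- Let N, p, q be such that 1 < p < N, 1 ≤ q < ∞, and q ≠ Np/(N−p). Let (v_n) be a sequence of differentiable functions v_n : ℝ^N → ℝ such that sup_n ‖v_n‖_{L^q(ℝ^N)} < ∞, sup_n ‖‖∇v_n‖‖_{L^p(ℝ^N)} < ∞ (the L^p norm of the pointwise norm of the gradient), and for some R > 0, sup_{y∈ℝ^N} ∫_{B_R(y)} |v_n|^q dx → 0 as n → ∞. Then for every α with q < α < Np/(N−p), one has ‖v_n‖_{L^α(ℝ^N)} → 0 as n → ∞. -/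
open MeasureTheory ENNReal

/-- Jensen/Hölder on a measure space. -/
lemma lv_jensen {X : Type*} [MeasurableSpace X] (μ : Measure X) {f : X → ℝ≥0∞}
    (hf : Measurable f) {r : ℝ} (hr : 1 ≤ r) :
    (∫⁻ x, f x ∂μ) ^ r ≤ (μ Set.univ) ^ (r - 1) * ∫⁻ x, f x ^ r ∂μ := by
  have h := eLpNorm'_le_eLpNorm'_mul_rpow_measure_univ (μ := μ) (f := f) zero_lt_one hr
    hf.aestronglyMeasurable
  simp only [eLpNorm', enorm_eq_self, ENNReal.rpow_one, div_one] at h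
  have hr0 : 0 < r := by linarith
  have h2 := ENNReal.rpow_le_rpow h hr0.le
  rw [ENNReal.mul_rpow_of_nonneg _ _ hr0.le, ← ENNReal.rpow_mul, ← ENNReal.rpow_mul,
    one_div_mul_cancel hr0.ne', ENNReal.rpow_one, mul_comm] at h2
  convert h2 using 3
  field_simp

/-- A form of Minkowski's integral inequality. -/
lemma lv_minkowski {X : Type*} [MeasurableSpace X] (ρ : Measure X) [SFinite ρ]
    (μ : Measure ℝ) [SFinite μ] (F : ℝ → X → ℝ≥0∞) (hF : Measurable (Function.uncurry F))
    (w : ℝ → ℝ≥0∞) (hw : Measurable w) (hw0 : ∀ᵐ t ∂μ, w t ≠ 0) (hw1 : ∀ᵐ t ∂μ, w t ≠ ∞)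
    (hZ : ∫⁻ t, w t ∂μ ≠ ∞) {r : ℝ} (hr : 1 ≤ r) (K : ℝ≥0∞)
    (hK : ∀ᵐ t ∂μ, ∫⁻ x, F t x ^ r ∂ρ ≤ K * w t ^ r) :
    ∫⁻ x, (∫⁻ t, F t x ∂μ) ^ r ∂ρ ≤ K * (∫⁻ t, w t ∂μ) ^ r := by
  set Z := ∫⁻ t, w t ∂μ with hZdef
  have hr0 : 0 < r := by linarith
  have hFx : ∀ x, Measurable (fun t => F t x) := fun x => by fun_prop
  have hFt : ∀ t, Measurable (fun x => F t x) := fun x => by fun_prop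
  haveI : IsFiniteMeasure (μ.withDensity w) := isFiniteMeasure_withDensity hZ
  have huniv : (μ.withDensity w) Set.univ = Z := by simp [hZdef]
  have key : ∀ x, (∫⁻ t, F t x ∂μ) ^ r ≤ Z ^ (r - 1) *
      ∫⁻ t, (F t x * (w t)⁻¹) ^ r ∂(μ.withDensity w) := by
    intro x
    have e : ∫⁻ t, F t x ∂μ = ∫⁻ t, F t x * (w t)⁻¹ ∂(μ.withDensity w) := by
      rw [lintegral_withDensity_eq_lintegral_mul _ hw (by fun_prop)]
      apply lintegral_congr_ae
      filter_upwards [hw0, hw1] with t h0 h1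
      simp only [Pi.mul_apply]
      rw [mul_comm, mul_assoc, ENNReal.inv_mul_cancel h0 h1, mul_one]
    rw [e, ← huniv]
    exact lv_jensen _ (by fun_prop) hr
  calc ∫⁻ x, (∫⁻ t, F t x ∂μ) ^ r ∂ρ
      ≤ ∫⁻ x, Z ^ (r - 1) * ∫⁻ t, (F t x * (w t)⁻¹) ^ r ∂(μ.withDensity w) ∂ρ :=
        lintegral_mono key
    _ = Z ^ (r - 1) * ∫⁻ x, ∫⁻ t, (F t x * (w t)⁻¹) ^ r ∂(μ.withDensity w) ∂ρ := by
        rw [lintegral_const_mul' _ _ (ENNReal.rpow_ne_top_of_nonneg (by linarith) hZ)]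
    _ = Z ^ (r - 1) * ∫⁻ t, ∫⁻ x, (F t x * (w t)⁻¹) ^ r ∂ρ ∂(μ.withDensity w) := by
        rw [lintegral_lintegral_swap]
        apply Measurable.aemeasurable
        fun_prop
    _ ≤ Z ^ (r - 1) * ∫⁻ t, K ∂(μ.withDensity w) := by
        gcongr Z ^ (r - 1) * ?_
        apply lintegral_mono_ae
        have hac : μ.withDensity w ≪ μ := withDensity_absolutelyContinuous _ _
        filter_upwards [hac.ae_le hw0, hac.ae_le hw1, hac.ae_le hK] with t h0 h1 h2
        simp_rw [ENNReal.mul_rpow_of_nonneg _ _ hr0.le]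
        rw [lintegral_mul_const _ (by fun_prop), ENNReal.inv_rpow]
        calc _ ≤ K * w t ^ r * (w t ^ r)⁻¹ := by gcongr
          _ = K := by
            rw [mul_assoc, ENNReal.mul_inv_cancel, mul_one]
            · simp [ENNReal.rpow_eq_zero_iff, h0, hr0.le, h1]
            · exact ENNReal.rpow_ne_top_of_nonneg hr0.le h1
    _ = K * Z ^ r := by
        rw [lintegral_const, huniv]
        conv_rhs => rw [show r = (r - 1) + 1 by ring, 
          ENNReal.rpow_add_of_nonneg _ _ (by linarith) zero_le_one, ENNReal.rpow_one]
        ring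

/-- FTC for everywhere differentiable functions. -/
lemma lv_ftc {E : Type*} [NormedAddCommGroup E] [NormedSpace ℝ E] [MeasurableSpace E]
    [BorelSpace E] {v : E → ℝ}
    (hv : Differentiable ℝ v) (x h : E) :
    ‖v (x + h) - v x‖ₑ ≤ ∫⁻ t in Set.Ioo (0:ℝ) 1, ‖fderiv ℝ v (x + t • h)‖ₑ * ‖h‖ₑ := by
  have hd : ∀ t : ℝ, HasDerivAt (fun t : ℝ => v (x + t • h)) (fderiv ℝ v (x + t • h) h) t := by
    intro t
    have h1 : HasDerivAt (fun t : ℝ => x + t • h) h t := by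
      simpa using ((hasDerivAt_id t).smul_const h).const_add x
    exact (hv _).hasFDerivAt.comp_hasDerivAt t h1
  have hle : ∫⁻ t in Set.Ioo (0:ℝ) 1, ‖fderiv ℝ v (x + t • h) h‖ₑ ≤
      ∫⁻ t in Set.Ioo (0:ℝ) 1, ‖fderiv ℝ v (x + t • h)‖ₑ * ‖h‖ₑ := by
    apply lintegral_mono
    intro t
    exact ContinuousLinearMap.le_opENorm _ _
  refine le_trans ?_ hle
  by_cases hfin : ∫⁻ t in Set.Ioo (0:ℝ) 1, ‖fderiv ℝ v (x + t • h) h‖ₑ = ∞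
  · rw [hfin]; exact le_top
  have hmeas : Measurable (fun t : ℝ => fderiv ℝ v (x + t • h) h) := by
    have : (fun t : ℝ => fderiv ℝ v (x + t • h) h) = deriv (fun t : ℝ => v (x + t • h)) := by
      ext t; exact (hd t).deriv.symm
    rw [this]; exact measurable_deriv _
  have hint : IntervalIntegrable (fun t : ℝ => fderiv ℝ v (x + t • h) h) volume 0 1 := by
    rw [intervalIntegrable_iff_integrableOn_Ioo_of_le zero_le_one]
    exact ⟨hmeas.aestronglyMeasurable, lt_top_iff_ne_top.2 hfin⟩
  have := intervalIntegral.integral_eq_sub_of_hasDerivAt (fun t _ => hd t) hint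
  simp only [one_smul, zero_smul, add_zero] at this
  rw [← this, intervalIntegral.integral_of_le zero_le_one, integral_Ioc_eq_integral_Ioo]
  exact enorm_integral_le_lintegral_enorm _

/-- Normalized Lebesgue measure on the unit ball. -/
noncomputable def lvNu (N : ℕ) : Measure (EuclideanSpace ℝ (Fin N)) :=
  (volume (Metric.ball (0 : EuclideanSpace ℝ (Fin N)) 1))⁻¹ •
    volume.restrict (Metric.ball (0 : EuclideanSpace ℝ (Fin N)) 1)

/-- The normalizing constant. -/
noncomputable def lvC (N : ℕ) : ℝ≥0∞ :=
  (volume (Metric.ball (0 : EuclideanSpace ℝ (Fin N)) 1))⁻¹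

lemma lvC_ne_top (N : ℕ) : lvC N ≠ ∞ := by
  unfold lvC
  exact ENNReal.inv_ne_top.2 (Metric.measure_ball_pos _ _ zero_lt_one).ne'

instance lvNu_prob (N : ℕ) : IsProbabilityMeasure (lvNu N) := by
  constructor
  simp only [lvNu, Measure.smul_apply, Measure.restrict_apply_univ, smul_eq_mul]
  exact ENNReal.inv_mul_cancel (Metric.measure_ball_pos _ _ zero_lt_one).ne' measure_ball_lt_top.ne

lemma lvNu_ae (N : ℕ) : ∀ᵐ h ∂(lvNu N), ‖h‖ ≤ 1 := by
  unfold lvNu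
  apply Measure.ae_smul_measure
  filter_upwards [ae_restrict_mem measurableSet_ball] with h hh
  simpa using (mem_ball_zero_iff.1 hh).le

/-- Averages over the ball of radius `δ`. -/
noncomputable def lvA {N : ℕ} (δ : ℝ) (f : EuclideanSpace ℝ (Fin N) → ℝ≥0∞)
    (x : EuclideanSpace ℝ (Fin N)) : ℝ≥0∞ := ∫⁻ h, f (x + δ • h) ∂(lvNu N)

lemma lvA_le {N : ℕ} {δ : ℝ} (hδ : 0 < δ) {f : EuclideanSpace ℝ (Fin N) → ℝ≥0∞}
    (hf : Measurable f) (x : EuclideanSpace ℝ (Fin N)) :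
    lvA δ f x ≤ lvC N * ENNReal.ofReal δ ^ (-(N : ℝ)) * ∫⁻ y in Metric.ball x δ, f y := by
  unfold lvA lvNu
  rw [lintegral_smul_measure, smul_eq_mul, mul_assoc]
  change lvC N * _ ≤ _
  gcongr
  have h1 : ∫⁻ h in Metric.ball (0 : EuclideanSpace ℝ (Fin N)) 1, f (x + δ • h) ≤
      ∫⁻ h, (Metric.ball x δ).indicator f (x + δ • h) := by
    rw [← lintegral_indicator measurableSet_ball]
    apply lintegral_mono
    intro h
    by_cases hh : h ∈ Metric.ball (0 : EuclideanSpace ℝ (Fin N)) 1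
    · have : x + δ • h ∈ Metric.ball x δ := by
        rw [Metric.mem_ball, dist_self_add_left, norm_smul, Real.norm_of_nonneg hδ.le]
        have := mem_ball_zero_iff.1 hh
        nlinarith
      simp [hh, this]
    · simp [hh]
  refine h1.trans (le_of_eq ?_)
  have hm : Measurable ((Metric.ball x δ).indicator f) := hf.indicator measurableSet_ball
  have h2 : ∫⁻ h, (Metric.ball x δ).indicator f (x + δ • h) =
      ∫⁻ z, (Metric.ball x δ).indicator f (x + z) ∂(Measure.map (δ • ·) volume) := by
    rw [lintegral_map (by fun_prop) (by fun_prop)]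
  rw [h2, Measure.map_addHaar_smul _ hδ.ne', lintegral_smul_measure,
    lintegral_add_left_eq_self, lintegral_indicator measurableSet_ball, smul_eq_mul]
  congr 1
  rw [finrank_euclideanSpace_fin, abs_of_pos (by positivity), ENNReal.ofReal_inv_of_pos (by positivity),
    ENNReal.ofReal_pow hδ.le, ENNReal.rpow_neg, ENNReal.rpow_natCast]

lemma lvA_lintegral {N : ℕ} (δ : ℝ) {f : EuclideanSpace ℝ (Fin N) → ℝ≥0∞}
    (hf : Measurable f) : ∫⁻ x, lvA δ f x = ∫⁻ x, f x := by
  unfold lvA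
  rw [lintegral_lintegral_swap (by apply Measurable.aemeasurable; fun_prop)]
  simp_rw [lintegral_add_right_eq_self]
  simp

lemma lvA_rpow_le {N : ℕ} (δ : ℝ) {f : EuclideanSpace ℝ (Fin N) → ℝ≥0∞}
    (hf : Measurable f) {a : ℝ} (ha : 1 ≤ a) (x) :
    lvA δ f x ^ a ≤ lvA δ (fun y => f y ^ a) x := by
  unfold lvA
  simpa using lv_jensen (lvNu N) (f := fun h => f (x + δ • h)) (by fun_prop) ha

lemma lvA_measurable {N : ℕ} {f : EuclideanSpace ℝ (Fin N) → ℝ≥0∞}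
    (hf : Measurable f) : Measurable (Function.uncurry fun δ x => lvA δ f x) := by
  unfold lvA Function.uncurry
  apply Measurable.lintegral_prod_right' (ν := lvNu N)
    (f := fun z : (ℝ × EuclideanSpace ℝ (Fin N)) × EuclideanSpace ℝ (Fin N) =>
      f (z.1.2 + z.1.1 • z.2))
  fun_prop

/-- L^r bound on averages. -/
lemma lvA_Lr {N : ℕ} (δ : ℝ) {f : EuclideanSpace ℝ (Fin N) → ℝ≥0∞}
    (hf : Measurable f) {a r : ℝ} (ha : 1 ≤ a) (har : a ≤ r) (S : ℝ≥0∞)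
    (hS : ∀ x, lvA δ (fun y => f y ^ a) x ≤ S) :
    ∫⁻ x, lvA δ f x ^ r ≤ S ^ ((r - a) / a) * ∫⁻ x, f x ^ a := by
  have hmA : Measurable (lvA δ (fun y => f y ^ a)) :=
    (lvA_measurable (hf.pow_const a)).comp (measurable_const.prodMk measurable_id)
  rw [← lvA_lintegral δ (hf.pow_const a), ← lintegral_const_mul _ hmA]
  apply lintegral_mono
  intro x
  have ha0 : 0 < a := by linarith
  have h1 := lvA_rpow_le δ hf ha x
  calc lvA δ f x ^ r = (lvA δ f x ^ a) ^ ((r - a) / a) * lvA δ f x ^ a := by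
        rw [← ENNReal.rpow_mul, mul_div_cancel₀ _ ha0.ne',
          ← ENNReal.rpow_add_of_nonneg _ _ (by linarith) ha0.le]
        congr 1; ring
    _ ≤ _ := by
        exact mul_le_mul' (ENNReal.rpow_le_rpow (h1.trans (hS x))
          (div_nonneg (by linarith) ha0.le)) h1

/-- Oscillation. -/
noncomputable def lvD {N : ℕ} (ε : ℝ) (v : EuclideanSpace ℝ (Fin N) → ℝ)
    (x : EuclideanSpace ℝ (Fin N)) : ℝ≥0∞ := ∫⁻ h, ‖v (x + ε • h) - v x‖ₑ ∂(lvNu N)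

lemma lvD_le {N : ℕ} {ε : ℝ} (hε : 0 < ε) {v : EuclideanSpace ℝ (Fin N) → ℝ}
    (hv : Differentiable ℝ v) (x) :
    lvD ε v x ≤ ENNReal.ofReal ε *
      ∫⁻ t in Set.Ioo (0:ℝ) 1, lvA (t * ε) (fun y => ‖fderiv ℝ v y‖ₑ) x := by
  have hg : Measurable (fun y => ‖fderiv ℝ v y‖ₑ) := (measurable_fderiv ℝ v).enorm
  unfold lvD lvA
  rw [lintegral_lintegral_swap (by
    apply Measurable.aemeasurable
    have : Measurable (fun z : ℝ × EuclideanSpace ℝ (Fin N) => x + (z.1 * ε) • z.2) := by fun_prop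
    exact hg.comp this), ← lintegral_const_mul' _ _ ENNReal.ofReal_ne_top]
  apply lintegral_mono_ae
  filter_upwards [lvNu_ae N] with h hh
  refine (lv_ftc hv x (ε • h)).trans ?_
  rw [← lintegral_const_mul' _ _ ENNReal.ofReal_ne_top]
  apply lintegral_mono
  intro t
  simp only
  rw [mul_comm, smul_smul]
  gcongr
  rw [← ofReal_norm, norm_smul, Real.norm_of_nonneg hε.le]
  apply ENNReal.ofReal_le_ofReal
  nlinarith

lemma lvD_Lr {N : ℕ} {p r : ℝ} (hp : 1 ≤ p) (hpr : p ≤ r) (hσ : N * ((r - p) / p) < r) :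
    ∃ Z : ℝ≥0∞, Z ≠ ∞ ∧ ∀ (v : EuclideanSpace ℝ (Fin N) → ℝ), Differentiable ℝ v →
    ∀ ε : ℝ, 0 < ε → ∫⁻ x, lvD ε v x ^ r ≤ ENNReal.ofReal ε ^ (r - N * ((r - p) / p)) *
      (Z * (∫⁻ x, ‖fderiv ℝ v x‖ₑ ^ p) ^ (r / p)) := by
  set s := (r - p) / p with hs
  have hp0 : 0 < p := by linarith
  have hr0 : 0 < r := by linarith
  have hs0 : 0 ≤ s := div_nonneg (by linarith) hp0.le
  set σ := N * s / r with hσd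
  have hσ1 : σ < 1 := by rw [hσd, div_lt_one hr0]; exact hσ
  set Z := ∫⁻ t in Set.Ioo (0:ℝ) 1, ENNReal.ofReal t ^ (-σ) with hZd
  have hZ : Z ≠ ∞ := by
    have h1 : IntegrableOn (fun t : ℝ => t ^ (-σ)) (Set.Ioo 0 1) :=
      (intervalIntegral.integrableOn_Ioo_rpow_iff zero_lt_one).2 (by linarith)
    have h2 : Z = ∫⁻ t in Set.Ioo (0:ℝ) 1, ‖t ^ (-σ)‖ₑ := by
      apply setLIntegral_congr_fun measurableSet_Ioo
      intro t ht
      simp only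
      rw [ENNReal.ofReal_rpow_of_pos ht.1, ← ofReal_norm,
        Real.norm_of_nonneg (Real.rpow_nonneg ht.1.le _)]
    rw [h2]
    exact h1.2.ne
  refine ⟨lvC N ^ s * Z ^ r, ENNReal.mul_ne_top
    (ENNReal.rpow_ne_top_of_nonneg hs0 (lvC_ne_top N)) (ENNReal.rpow_ne_top_of_nonneg hr0.le hZ), ?_⟩
  intro v hv ε hε
  set g : EuclideanSpace ℝ (Fin N) → ℝ≥0∞ := fun y => ‖fderiv ℝ v y‖ₑ with hgd
  have hg : Measurable g := (measurable_fderiv ℝ v).enorm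
  set G := ∫⁻ x, g x ^ p with hG
  have hε0 : ENNReal.ofReal ε ≠ 0 := by simpa using hε
  have hεt : ENNReal.ofReal ε ≠ ∞ := ENNReal.ofReal_ne_top
  have hM : Measurable (Function.uncurry fun (t : ℝ) x => lvA (t * ε) g x) :=
    (lvA_measurable hg).comp
      (f := fun z : ℝ × EuclideanSpace ℝ (Fin N) => (z.1 * ε, z.2)) (by fun_prop)
  have hmink := lv_minkowski (volume : Measure (EuclideanSpace ℝ (Fin N)))
    (volume.restrict (Set.Ioo (0:ℝ) 1)) (fun t x => lvA (t * ε) g x) hM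
    (fun t => ENNReal.ofReal t ^ (-σ)) (by fun_prop)
    (by
      filter_upwards [ae_restrict_mem measurableSet_Ioo] with t ht
      have := ht.1
      rw [ENNReal.ofReal_rpow_of_pos this]
      simpa using Real.rpow_pos_of_pos this _)
    (by
      filter_upwards [ae_restrict_mem measurableSet_Ioo] with t ht
      rw [ENNReal.ofReal_rpow_of_pos ht.1]
      exact ENNReal.ofReal_ne_top)
    hZ (hp.trans hpr) (lvC N ^ s * ENNReal.ofReal ε ^ (-(N * s)) * G ^ (r / p))
    (by
      filter_upwards [ae_restrict_mem measurableSet_Ioo] with t ht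
      have ht0 : ENNReal.ofReal t ≠ 0 := by simpa using ht.1
      refine (lvA_Lr (t * ε) hg hp hpr
        (lvC N * ENNReal.ofReal (t * ε) ^ (-(N : ℝ)) * G) ?_).trans (le_of_eq ?_)
      · intro x
        refine (lvA_le (mul_pos ht.1 hε) (hg.pow_const p) x).trans ?_
        gcongr
        exact setLIntegral_le_lintegral _ _
      · rw [← hs, ENNReal.mul_rpow_of_nonneg _ _ hs0, ENNReal.mul_rpow_of_nonneg _ _ hs0,
          ENNReal.ofReal_mul ht.1.le, ← ENNReal.rpow_mul, ← ENNReal.rpow_mul,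
          ENNReal.mul_rpow_of_ne_zero ht0 hε0]
        have e1 : -σ * r = -(N : ℝ) * s := by rw [hσd]; field_simp
        have e2 : G ^ (r / p) = G ^ s * G := by
          conv_rhs => rw [← ENNReal.rpow_one G, ← ENNReal.rpow_mul, one_mul,
            ← ENNReal.rpow_add_of_nonneg _ _ hs0 zero_le_one]
          congr 1; rw [hs]; field_simp; ring
        rw [e1, e2, neg_mul]
        ring)
  have hr1 : ∫⁻ x, lvD ε v x ^ r ≤ ENNReal.ofReal ε ^ r *
      ∫⁻ x, (∫⁻ t in Set.Ioo (0:ℝ) 1, lvA (t * ε) g x) ^ r := by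
    rw [← lintegral_const_mul' _ _ (ENNReal.rpow_ne_top_of_nonneg hr0.le hεt)]
    apply lintegral_mono
    intro x
    simp only
    rw [← ENNReal.mul_rpow_of_nonneg _ _ hr0.le]
    gcongr
    exact lvD_le hε hv x
  refine hr1.trans ((mul_le_mul_right hmink _).trans (le_of_eq ?_))
  rw [sub_eq_add_neg, ENNReal.rpow_add _ _ hε0 hεt]
  ring

lemma lv_interp {X : Type*} [MeasurableSpace X] (μ : Measure X) {f : X → ℝ≥0∞}
    (hf : Measurable f) {q α β : ℝ} (hq : 0 < q) (hqα : q < α) (hαβ : α < β) {l : ℝ} (hl : 0 < l) :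
    ∫⁻ x, f x ^ α ∂μ ≤ ENNReal.ofReal l ^ (α - q) * ∫⁻ x, f x ^ q ∂μ +
      ENNReal.ofReal l ^ (α - β) * ∫⁻ x, f x ^ β ∂μ := by
  have hl0 : ENNReal.ofReal l ≠ 0 := by simpa using hl
  have hlt : ENNReal.ofReal l ≠ ∞ := ENNReal.ofReal_ne_top
  rw [← lintegral_const_mul _ (by fun_prop), ← lintegral_const_mul _ (by fun_prop),
    ← lintegral_add_left (by fun_prop)]
  apply lintegral_mono
  intro x
  simp only
  rcases le_total (f x) (ENNReal.ofReal l) with h | h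
  · refine le_trans ?_ le_self_add
    calc f x ^ α = f x ^ (α - q) * f x ^ q := by
          rw [← ENNReal.rpow_add_of_nonneg _ _ (by linarith) hq.le]; congr 1; ring
      _ ≤ _ := by gcongr
  · refine le_trans ?_ le_add_self
    calc f x ^ α = ENNReal.ofReal l ^ (α - β) * (ENNReal.ofReal l ^ (β - α) * f x ^ α) := by
          rw [← mul_assoc, ← ENNReal.rpow_add _ _ hl0 hlt]; simp
      _ ≤ ENNReal.ofReal l ^ (α - β) * (f x ^ (β - α) * f x ^ α) := by gcongr
      _ = _ := by
          rw [← ENNReal.rpow_add_of_nonneg _ _ (by linarith) (by linarith)]; congr 2; ring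

lemma lv_eLpNorm_eq {N : ℕ} (f : EuclideanSpace ℝ (Fin N) → ℝ) {a : ℝ} (ha : 0 < a) :
    eLpNorm f (ENNReal.ofReal a) volume = (∫⁻ x, ‖f x‖ₑ ^ a) ^ (1 / a) := by
  rw [eLpNorm_eq_lintegral_rpow_enorm_toReal (by simpa using ha) ENNReal.ofReal_ne_top,
    ENNReal.toReal_ofReal ha.le]

lemma lv_bound {N : ℕ} {f : EuclideanSpace ℝ (Fin N) → ℝ} {a C : ℝ} (ha : 0 < a)
    (h : eLpNorm f (ENNReal.ofReal a) volume ≤ ENNReal.ofReal C) :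
    ∫⁻ x, ‖f x‖ₑ ^ a ≤ ENNReal.ofReal C ^ a := by
  rw [lv_eLpNorm_eq f ha] at h
  have := ENNReal.rpow_le_rpow h ha.le
  rwa [← ENNReal.rpow_mul, one_div_mul_cancel ha.ne', ENNReal.rpow_one] at this

lemma lv_small_rpow {k : ℝ} (hk : 0 < k) {K η : ℝ≥0∞} (hK : K ≠ ∞) (hη : 0 < η) {R : ℝ}
    (hR : 0 < R) : ∃ ε : ℝ, 0 < ε ∧ ε ≤ R ∧ ENNReal.ofReal ε ^ k * K ≤ η := by
  have h1 : Filter.Tendsto (fun ε : ℝ => ENNReal.ofReal ε ^ k * K) (nhdsWithin 0 (Set.Ioi 0))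
      (nhds 0) := by
    have h2 : Filter.Tendsto (fun ε : ℝ => ENNReal.ofReal ε ^ k) (nhds 0) (nhds 0) := by
      have : Continuous (fun ε : ℝ => ENNReal.ofReal ε ^ k) :=
        (ENNReal.continuous_rpow_const).comp ENNReal.continuous_ofReal
      simpa [hk] using this.tendsto 0
    have h3 := ENNReal.Tendsto.mul_const (b := K) h2 (Or.inr hK)
    rw [zero_mul] at h3
    exact h3.mono_left nhdsWithin_le_nhds
  have h4 := (ENNReal.tendsto_nhds_zero.1 h1) η hη
  have h5 : ∀ᶠ ε : ℝ in nhdsWithin 0 (Set.Ioi 0), ε ∈ Set.Ioc 0 R := Ioc_mem_nhdsGT hR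
  obtain ⟨ε, h6, h7⟩ := (h4.and h5).exists
  exact ⟨ε, h7.1, h7.2, h6⟩

lemma lv_core (N : ℕ) (p q : ℝ) (hp : 1 < p) (hq1 : 1 ≤ q)
    (v : ℕ → EuclideanSpace ℝ (Fin N) → ℝ)
    (hdiff : ∀ n, Differentiable ℝ (v n)) (Q P : ℝ≥0∞) (hQ : Q ≠ ∞) (hP : P ≠ ∞)
    (hbq : ∀ n, ∫⁻ x, ‖v n x‖ₑ ^ q ≤ Q) (hbp : ∀ n, ∫⁻ x, ‖fderiv ℝ (v n) x‖ₑ ^ p ≤ P)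
    (R : ℝ) (hR : 0 < R)
    (hvan : Filter.Tendsto
      (fun n => ⨆ y : EuclideanSpace ℝ (Fin N),
        ∫⁻ x in Metric.ball y R, ‖v n x‖ₑ ^ q) Filter.atTop (nhds 0))
    (r : ℝ) (hpr : p ≤ r) (hqr : q < r) (hσ : N * ((r - p) / p) < r) :
    Filter.Tendsto (fun n => ∫⁻ x, ‖v n x‖ₑ ^ r) Filter.atTop (nhds 0) := by
  obtain ⟨Z, hZ, hD⟩ := lvD_Lr (N := N) hp.le hpr hσ
  have hr0 : 0 < r := by linarith
  have hq0 : 0 < q := by linarith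
  have hp0 : 0 < p := by linarith
  rw [ENNReal.tendsto_nhds_zero]
  intro η hη
  have hη2 : 0 < η / 2 := ENNReal.half_pos hη.ne'
  set B : ℝ≥0∞ := 2 ^ (r - 1) with hB
  have hBt : B ≠ ∞ := ENNReal.rpow_ne_top_of_nonneg (by linarith) (by simp)
  obtain ⟨ε, hε, hεR, hsmall⟩ := lv_small_rpow (k := r - N * ((r - p) / p)) (by linarith)
    (K := B * (Z * P ^ (r / p)))
    (ENNReal.mul_ne_top hBt (ENNReal.mul_ne_top hZ (ENNReal.rpow_ne_top_of_nonneg (by positivity) hP)))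
    hη2 hR
  have hε0 : ENNReal.ofReal ε ≠ 0 := by simpa using hε
  set c := lvC N * ENNReal.ofReal ε ^ (-(N : ℝ)) with hc
  have hct : c ≠ ∞ := by
    apply ENNReal.mul_ne_top (lvC_ne_top N)
    rw [ENNReal.ofReal_rpow_of_pos hε]; exact ENNReal.ofReal_ne_top
  set S := fun n => ⨆ y : EuclideanSpace ℝ (Fin N),
        ∫⁻ x in Metric.ball y R, ‖v n x‖ₑ ^ q with hS
  have he : 0 < (r - q) / q := div_pos (by linarith) hq0
  have hlim : Filter.Tendsto (fun n => B * ((c * S n) ^ ((r - q) / q) * Q)) Filter.atTop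
      (nhds 0) := by
    have h1 := ENNReal.Tendsto.const_mul (a := c) hvan (Or.inr hct)
    have h2 := h1.ennrpow_const ((r - q) / q)
    have h3 := ENNReal.Tendsto.mul_const (b := Q) h2 (Or.inr hQ)
    have h4 := ENNReal.Tendsto.const_mul (a := B) h3 (Or.inr hBt)
    simpa [he] using h4
  filter_upwards [(ENNReal.tendsto_nhds_zero.1 hlim) _ hη2] with n hn
  have hvm : Measurable (fun x => ‖v n x‖ₑ) := (hdiff n).continuous.measurable.enorm
  have hA : ∫⁻ x, lvA ε (fun y => ‖v n y‖ₑ) x ^ r ≤ (c * S n) ^ ((r - q) / q) * Q := by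
    refine (lvA_Lr ε hvm hq1 hqr.le (c * S n) ?_).trans (mul_le_mul_right (hbq n) _)
    intro x
    refine (lvA_le hε (hvm.pow_const q) x).trans ?_
    gcongr
    refine le_trans ?_ (le_iSup (fun y : EuclideanSpace ℝ (Fin N) =>
      ∫⁻ x in Metric.ball y R, ‖v n x‖ₑ ^ q) x)
    exact lintegral_mono_set (Metric.ball_subset_ball hεR)
  have hDn := (hD (v n) (hdiff n) ε hε)
  have hmA : Measurable (lvA ε (fun y => ‖v n y‖ₑ)) :=
    (lvA_measurable hvm).comp (measurable_const.prodMk measurable_id)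
  have hpt : ∀ x, ‖v n x‖ₑ ≤ lvD ε (v n) x + lvA ε (fun y => ‖v n y‖ₑ) x := by
    intro x
    unfold lvD lvA
    have hm2 : Measurable fun h => (fun y => ‖v n y‖ₑ) (x + ε • h) :=
      hvm.comp (by fun_prop : Measurable fun h => x + ε • h)
    rw [← lintegral_add_right _ hm2]
    calc ‖v n x‖ₑ = ∫⁻ _, ‖v n x‖ₑ ∂(lvNu N) := by simp
      _ ≤ _ := by
        apply lintegral_mono
        intro h
        simp only
        calc ‖v n x‖ₑ = ‖-(v n (x + ε • h) - v n x) + v n (x + ε • h)‖ₑ := by congr 1; ring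
          _ ≤ _ := (enorm_add_le _ _).trans (by rw [enorm_neg])
  calc ∫⁻ x, ‖v n x‖ₑ ^ r
      ≤ ∫⁻ x, B * (lvD ε (v n) x ^ r + lvA ε (fun y => ‖v n y‖ₑ) x ^ r) := by
        apply lintegral_mono
        intro x
        refine (ENNReal.rpow_le_rpow (hpt x) hr0.le).trans ?_
        exact ENNReal.rpow_add_le_mul_rpow_add_rpow _ _ (by linarith)
    _ = B * (∫⁻ x, lvD ε (v n) x ^ r) + B * ∫⁻ x, lvA ε (fun y => ‖v n y‖ₑ) x ^ r := by
        rw [lintegral_const_mul' _ _ hBt, lintegral_add_right _ (by fun_prop), mul_add]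
    _ ≤ η / 2 + η / 2 := by
        refine add_le_add ?_ ((mul_le_mul_right hA _).trans hn)
        refine (mul_le_mul_right hDn _).trans (le_trans ?_ hsmall)
        calc _ ≤ B * (ENNReal.ofReal ε ^ (r - N * ((r - p) / p)) * (Z * P ^ (r / p))) := by
              gcongr
              exact hbp n
          _ = _ := by ring
    _ = η := ENNReal.add_halves η

/-- Lions-type vanishing lemma. -/
theorem lions_vanishing (N : ℕ) (p q : ℝ) (hp : 1 < p) (hpN : p < N) (hq1 : 1 ≤ q)
    (hq : q ≠ N * p / (N - p))
    (v : ℕ → EuclideanSpace ℝ (Fin N) → ℝ)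
    (hdiff : ∀ n, Differentiable ℝ (v n))
    (hbq : ∃ C : ℝ, ∀ n, eLpNorm (v n) (ENNReal.ofReal q) volume ≤ ENNReal.ofReal C)
    (hbp : ∃ C : ℝ, ∀ n,
      eLpNorm (fun x => ‖fderiv ℝ (v n) x‖) (ENNReal.ofReal p) volume ≤ ENNReal.ofReal C)
    (R : ℝ) (hR : 0 < R)
    (hvan : Filter.Tendsto
      (fun n => ⨆ y : EuclideanSpace ℝ (Fin N),
        ∫⁻ x in Metric.ball y R, ENNReal.ofReal (|v n x| ^ q))
      Filter.atTop (nhds 0)) :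
    ∀ α : ℝ, q < α → α < N * p / (N - p) →
      Filter.Tendsto (fun n => eLpNorm (v n) (ENNReal.ofReal α) volume)
        Filter.atTop (nhds 0) := by
  intro α hqα hα
  have hq0 : 0 < q := by linarith
  have hp0 : 0 < p := by linarith
  have hα0 : 0 < α := by linarith
  obtain ⟨C₁, hC₁⟩ := hbq
  obtain ⟨C₂, hC₂⟩ := hbp
  have hQ : ENNReal.ofReal C₁ ^ q ≠ ∞ := ENNReal.rpow_ne_top_of_nonneg hq0.le ENNReal.ofReal_ne_top
  have hP : ENNReal.ofReal C₂ ^ p ≠ ∞ := ENNReal.rpow_ne_top_of_nonneg hp0.le ENNReal.ofReal_ne_top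
  have hbq' : ∀ n, ∫⁻ x, ‖v n x‖ₑ ^ q ≤ ENNReal.ofReal C₁ ^ q := fun n => lv_bound hq0 (hC₁ n)
  have hbp' : ∀ n, ∫⁻ x, ‖fderiv ℝ (v n) x‖ₑ ^ p ≤ ENNReal.ofReal C₂ ^ p := fun n => by
    simpa using lv_bound hp0 (hC₂ n)
  have hvan' : Filter.Tendsto
      (fun n => ⨆ y : EuclideanSpace ℝ (Fin N),
        ∫⁻ x in Metric.ball y R, ‖v n x‖ₑ ^ q) Filter.atTop (nhds 0) := by
    convert hvan using 6
    rw [← ENNReal.ofReal_rpow_of_nonneg (abs_nonneg _) hq0.le, Real.enorm_eq_ofReal_abs]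
  have core := lv_core N p q hp hq1 v hdiff _ _ hQ hP hbq' hbp' R hR hvan'
  have hmain : Filter.Tendsto (fun n => ∫⁻ x, ‖v n x‖ₑ ^ α) Filter.atTop (nhds 0) := by
    rcases le_or_gt p α with hpα | hαp
    · apply core α hpα hqα
      rw [lt_div_iff₀ (by linarith)] at hα
      rw [← mul_div_assoc, div_lt_iff₀ hp0]
      nlinarith
    · have hcp := core p le_rfl (hqα.trans hαp) (by simpa using hp0)
      rw [ENNReal.tendsto_nhds_zero]
      intro η hη
      have hη2 : 0 < η / 2 := ENNReal.half_pos hη.ne'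
      obtain ⟨l, hl, -, hl2⟩ := lv_small_rpow (k := α - q) (by linarith) hQ hη2 zero_lt_one
      have hlt : ENNReal.ofReal l ^ (α - p) ≠ ∞ := by
        rw [ENNReal.ofReal_rpow_of_pos hl]; exact ENNReal.ofReal_ne_top
      have hlim := ENNReal.Tendsto.const_mul (a := ENNReal.ofReal l ^ (α - p)) hcp (Or.inr hlt)
      rw [mul_zero] at hlim
      filter_upwards [(ENNReal.tendsto_nhds_zero.1 hlim) _ hη2] with n hn
      have hvm : Measurable (fun x => ‖v n x‖ₑ) := (hdiff n).continuous.measurable.enorm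
      refine (lv_interp volume hvm hq0 hqα hαp hl).trans ?_
      rw [← ENNReal.add_halves η]
      exact add_le_add ((mul_le_mul_right (hbq' n) _).trans hl2) hn
  have h2 := hmain.ennrpow_const (1 / α)
  rw [ENNReal.zero_rpow_of_pos (by positivity)] at h2
  simpa only [lv_eLpNorm_eq _ hα0] using h2
end

section
/- Let 1 < p < N, 0 < μ < N, 1 ≤ θ < (2N−μ)/(N−p), a, b, V∞ > 0, and A, C, D > 0. Define h : (0,∞) → ℝ by h(t) := (a/p)·t^{N−p}·A + (b/(pθ))·t^{(N−p)θ}·A^θ + (V∞/p)·t^{N}·C − (1/2)·t^{2N−μ}·D. Then there exists a unique t̃ > 0 such that h'(t̃) = 0; moreover h(t̃) = sup_{t>0} h(t), i.e. h attains its maximum over (0,∞) at t̃. -/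
theorem fibering_aux (α β γ δ c1 c2 c3 c4 : ℝ) (hα : 0 < α) (hβ : 0 < β) (hγ : 0 < γ)
    (hαδ : α < δ) (hβδ : β < δ) (hγδ : γ < δ)
    (h1 : 0 < c1) (h2 : 0 < c2) (h3 : 0 < c3) (h4 : 0 < c4) (f : ℝ → ℝ)
    (hf : ∀ t, f t = c1 * t ^ α + c2 * t ^ β + c3 * t ^ γ - c4 * t ^ δ) :
    ∃ t₀ : ℝ, 0 < t₀ ∧ deriv f t₀ = 0 ∧ (∀ t : ℝ, 0 < t → f t ≤ f t₀) ∧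
      ∀ t : ℝ, 0 < t → deriv f t = 0 → t = t₀ := by
  have hδ : 0 < δ := hα.trans hαδ
  obtain ⟨G, hG⟩ : ∃ G : ℝ → ℝ, G = fun t => c1 * α * t ^ (-(δ - α)) + c2 * β * t ^ (-(δ - β))
    + c3 * γ * t ^ (-(δ - γ)) - c4 * δ := ⟨_, rfl⟩
  have hd : ∀ t : ℝ, 0 < t → HasDerivAt f (t ^ (δ - 1) * G t) t := by
    intro t ht
    have e : f = fun t => c1 * t ^ α + c2 * t ^ β + c3 * t ^ γ - c4 * t ^ δ := funext hf
    have k := fun q : ℝ => Real.hasDerivAt_rpow_const (x := t) (p := q) (Or.inl ht.ne')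
    have m : ∀ q : ℝ, t ^ (δ - 1) * t ^ (-(δ - q)) = t ^ (q - 1) := by
      intro q
      rw [← Real.rpow_add ht]
      congr 1
      ring
    rw [e]
    refine (((((k α).const_mul c1).add ((k β).const_mul c2)).add ((k γ).const_mul c3)).sub
      ((k δ).const_mul c4)).congr_deriv ?_
    rw [← m α, ← m β, ← m γ, hG]
    ring
  have hanti : ∀ x y : ℝ, 0 < x → x < y → G y < G x := by
    intro x y hx hxy
    have k : ∀ q : ℝ, q < δ → y ^ (-(δ - q)) < x ^ (-(δ - q)) := fun q hq =>
      Real.rpow_lt_rpow_of_neg hx hxy (by linarith)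
    have k1 := mul_lt_mul_of_pos_left (k α hαδ) (mul_pos h1 hα)
    have k2 := mul_lt_mul_of_pos_left (k β hβδ) (mul_pos h2 hβ)
    have k3 := mul_lt_mul_of_pos_left (k γ hγδ) (mul_pos h3 hγ)
    simp only [hG]
    linarith
  have hcont : ContinuousOn G (Set.Ioi 0) := by
    have k : ∀ q : ℝ, ContinuousOn (fun t : ℝ => t ^ q) (Set.Ioi 0) := fun q t ht =>
      (Real.continuousAt_rpow_const t q (Or.inl (ne_of_gt ht))).continuousWithinAt
    rw [hG]
    exact ((((k _).const_mul _).add ((k _).const_mul _)).add ((k _).const_mul _)).sub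
      continuousOn_const
  have hpos : ∃ s : ℝ, 0 < s ∧ 0 < G s := by
    have hr : 0 < c4 * δ / (c1 * α) := by positivity
    refine ⟨(c4 * δ / (c1 * α)) ^ (-(δ - α))⁻¹, Real.rpow_pos_of_pos hr _, ?_⟩
    have hs := Real.rpow_pos_of_pos hr (-(δ - α))⁻¹
    have e := Real.rpow_inv_rpow hr.le (y := -(δ - α)) (by linarith)
    simp only [hG]
    rw [e]
    have e2 : c1 * α * (c4 * δ / (c1 * α)) = c4 * δ := by field_simp
    rw [e2]
    have k2 := mul_pos (mul_pos h2 hβ) (Real.rpow_pos_of_pos hs (-(δ - β)))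
    have k3 := mul_pos (mul_pos h3 hγ) (Real.rpow_pos_of_pos hs (-(δ - γ)))
    linarith
  have hneg : ∃ s : ℝ, 0 < s ∧ G s < 0 := by
    have k : ∀ q : ℝ, q < δ → Filter.Tendsto (fun t : ℝ => t ^ (-(δ - q))) Filter.atTop (nhds 0) :=
      fun q hq => tendsto_rpow_neg_atTop (by linarith)
    have T : Filter.Tendsto G Filter.atTop
        (nhds (c1 * α * 0 + c2 * β * 0 + c3 * γ * 0 - c4 * δ)) := by
      rw [hG]
      exact (((((k α hαδ).const_mul _).add ((k β hβδ).const_mul _)).add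
        ((k γ hγδ).const_mul _))).sub tendsto_const_nhds
    have hl : c1 * α * 0 + c2 * β * 0 + c3 * γ * 0 - c4 * δ < 0 := by
      have := mul_pos h4 hδ
      linarith
    exact ((Filter.eventually_gt_atTop 0).and (T.eventually_lt_const hl)).exists
  obtain ⟨s, hs, hGs⟩ := hpos
  obtain ⟨r, hr, hGr⟩ := hneg
  obtain ⟨t₀, ht₀, hz⟩ := isPreconnected_Ioi.intermediate_value (show r ∈ Set.Ioi (0:ℝ) from hr)
    (show s ∈ Set.Ioi (0:ℝ) from hs) hcont ⟨hGr.le, hGs.le⟩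
  have ht₀ : 0 < t₀ := ht₀
  have hp := fun t (ht : 0 < t) => Real.rpow_pos_of_pos ht (δ - 1)
  refine ⟨t₀, ht₀, by rw [(hd t₀ ht₀).deriv, hz, mul_zero], ?_, ?_⟩
  · intro t ht
    rcases le_total t t₀ with h | h
    · refine monotoneOn_of_deriv_nonneg (convex_Icc t t₀) (fun x hx =>
        (hd x (ht.trans_le hx.1)).continuousAt.continuousWithinAt) ?_ ?_
        (Set.left_mem_Icc.2 h) (Set.right_mem_Icc.2 h) h
      · rw [interior_Icc]
        exact fun x hx => (hd x (ht.trans hx.1)).differentiableAt.differentiableWithinAt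
      · rw [interior_Icc]
        intro x hx
        have hx0 := ht.trans hx.1
        rw [(hd x hx0).deriv]
        have := hanti x t₀ hx0 hx.2
        exact mul_nonneg (hp x hx0).le (by linarith)
    · refine antitoneOn_of_deriv_nonpos (convex_Icc t₀ t) (fun x hx =>
        (hd x (ht₀.trans_le hx.1)).continuousAt.continuousWithinAt) ?_ ?_
        (Set.left_mem_Icc.2 h) (Set.right_mem_Icc.2 h) h
      · rw [interior_Icc]
        exact fun x hx => (hd x (ht₀.trans hx.1)).differentiableAt.differentiableWithinAt
      · rw [interior_Icc]
        intro x hx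
        have hx0 := ht₀.trans hx.1
        rw [(hd x hx0).deriv]
        have := hanti t₀ x ht₀ hx.1
        exact mul_nonpos_of_nonneg_of_nonpos (hp x hx0).le (by linarith)
  · intro t ht h
    rw [(hd t ht).deriv] at h
    have h0 : G t = 0 := (mul_eq_zero.1 h).resolve_left (hp t ht).ne'
    rcases lt_trichotomy t t₀ with k | k | k
    · have := hanti t t₀ ht k
      linarith
    · exact k
    · have := hanti t₀ t ht₀ k
      linarith

/-- The fibering map `h(t) = J∞(u_t)` has a unique positive critical point, at
which it attains its maximum over `(0, ∞)`. -/
theorem unique_critical_point_fibering (N : ℕ) (p μ θ a b Vinf A C D : ℝ)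
    (hp : 1 < p) (hpN : p < N) (hμ0 : 0 < μ) (hμN : μ < N)
    (hθ1 : 1 ≤ θ) (hθ2 : θ < (2 * N - μ) / (N - p))
    (ha : 0 < a) (hb : 0 < b) (hVinf : 0 < Vinf)
    (hA : 0 < A) (hC : 0 < C) (hD : 0 < D) :
    ∃ t₀ : ℝ, 0 < t₀ ∧
      deriv (fun t : ℝ =>
        (a / p) * t ^ ((N : ℝ) - p) * A
          + (b / (p * θ)) * t ^ (((N : ℝ) - p) * θ) * A ^ θ
          + (Vinf / p) * t ^ (N : ℝ) * C
          - (1 / 2) * t ^ (2 * (N : ℝ) - μ) * D) t₀ = 0 ∧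
      (∀ t : ℝ, 0 < t →
        (a / p) * t ^ ((N : ℝ) - p) * A
          + (b / (p * θ)) * t ^ (((N : ℝ) - p) * θ) * A ^ θ
          + (Vinf / p) * t ^ (N : ℝ) * C
          - (1 / 2) * t ^ (2 * (N : ℝ) - μ) * D
        ≤ (a / p) * t₀ ^ ((N : ℝ) - p) * A
            + (b / (p * θ)) * t₀ ^ (((N : ℝ) - p) * θ) * A ^ θ
            + (Vinf / p) * t₀ ^ (N : ℝ) * C
            - (1 / 2) * t₀ ^ (2 * (N : ℝ) - μ) * D) ∧
      ∀ t : ℝ, 0 < t →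
        deriv (fun s : ℝ =>
          (a / p) * s ^ ((N : ℝ) - p) * A
            + (b / (p * θ)) * s ^ (((N : ℝ) - p) * θ) * A ^ θ
            + (Vinf / p) * s ^ (N : ℝ) * C
            - (1 / 2) * s ^ (2 * (N : ℝ) - μ) * D) t = 0 → t = t₀ := by
  have hNp : 0 < (N : ℝ) - p := by linarith
  have hp0 : 0 < p := by linarith
  have hθ0 : 0 < θ := by linarith
  have hN0 : 0 < (N : ℝ) := by linarith
  rw [lt_div_iff₀ hNp] at hθ2
  have hAθ := Real.rpow_pos_of_pos hA θ
  refine fibering_aux ((N : ℝ) - p) (((N : ℝ) - p) * θ) N (2 * N - μ) (a / p * A)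
    (b / (p * θ) * A ^ θ) (Vinf / p * C) (1 / 2 * D) hNp (mul_pos hNp hθ0) hN0
    (by linarith) (by linarith) (by linarith) (by positivity) (by positivity) (by positivity)
    (by positivity) (fun t : ℝ =>
        (a / p) * t ^ ((N : ℝ) - p) * A
          + (b / (p * θ)) * t ^ (((N : ℝ) - p) * θ) * A ^ θ
          + (Vinf / p) * t ^ (N : ℝ) * C
          - (1 / 2) * t ^ (2 * (N : ℝ) - μ) * D) ?_
  intro t
  ring
end

section
/- Let N ≥ 1, 0 < μ < N, let e ∈ ℝ^N with ‖e‖ = 1 and c ∈ ℝ, and set H := {x ∈ ℝ^N : ⟨x,e⟩ ≥ c} with reflection σ(x) := x − 2(⟨x,e⟩ − c)e. Let u : ℝ^N → ℝ be measurable and define the polarization u^H(x) := max{u(x), u(σ(x))} if x ∈ H and u^H(x) := min{u(x), u(σ(x))} if x ∉ H. Let F : ℝ → ℝ be monotone nondecreasing with F(t) = 0 for all t ≤ 0. Then ∬_{ℝ^N×ℝ^N} F(u(x))F(u(y))/‖x−y‖^μ dx dy ≤ ∬_{ℝ^N×ℝ^N} F(u^H(x))F(u^H(y))/‖x−y‖^μ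 dx dy, where both sides are (possibly infinite) Lebesgue integrals of nonnegative functions. -/
open MeasureTheory RealInnerProductSpace

/-- Reflection across the boundary hyperplane of the half-space
`H = {x : ⟨x, e⟩ ≥ c}`. -/
noncomputable def reflectHalfSpace {N : ℕ} (e : EuclideanSpace ℝ (Fin N)) (c : ℝ)
    (x : EuclideanSpace ℝ (Fin N)) : EuclideanSpace ℝ (Fin N) :=
  x - (2 * (⟪x, e⟫ - c)) • e

/-- Polarization of `u` with respect to the half-space `H = {x : ⟨x, e⟩ ≥ c}`. -/
noncomputable def polarization {N : ℕ} (e : EuclideanSpace ℝ (Fin N)) (c : ℝ)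
    (u : EuclideanSpace ℝ (Fin N) → ℝ) (x : EuclideanSpace ℝ (Fin N)) : ℝ :=
  if c ≤ ⟪x, e⟫ then max (u x) (u (reflectHalfSpace e c x))
  else min (u x) (u (reflectHalfSpace e c x))

/-- Real four-point inequality. -/
lemma four_point (A B p q r s : ℝ) (hAB : B ≤ A) :
    A * (p * r + q * s) + B * (q * r + p * s) ≤
      A * (max p q * max r s + min p q * min r s) +
        B * (min p q * max r s + max p q * min r s) := by
  rcases le_total p q with h | h <;> rcases le_total r s with h' | h' <;>
    simp only [max_eq_left, max_eq_right, min_eq_left, min_eq_right, h, h'] <;>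
    nlinarith [mul_nonneg (sub_nonneg.2 hAB) (mul_nonneg (sub_nonneg.2 h) (sub_nonneg.2 h'))]

section aux
variable {N : ℕ} (e : EuclideanSpace ℝ (Fin N)) (c : ℝ)

lemma reflectHalfSpace_inner (he : ‖e‖ = 1) (x : EuclideanSpace ℝ (Fin N)) :
    ⟪reflectHalfSpace e c x, e⟫ = 2 * c - ⟪x, e⟫ := by
  simp only [reflectHalfSpace, inner_sub_left, real_inner_smul_left, real_inner_self_eq_norm_sq, he]
  ring

lemma reflectHalfSpace_invol (he : ‖e‖ = 1) (x : EuclideanSpace ℝ (Fin N)) :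
    reflectHalfSpace e c (reflectHalfSpace e c x) = x := by
  have h := reflectHalfSpace_inner e c he x
  rw [reflectHalfSpace, h]
  simp only [reflectHalfSpace]
  module

lemma reflectHalfSpace_eq (he : ‖e‖ = 1) (x : EuclideanSpace ℝ (Fin N)) :
    reflectHalfSpace e c x = (ℝ ∙ e)ᗮ.reflection x + (2 * c) • e := by
  rw [Submodule.reflection_orthogonal_apply, Submodule.reflection_singleton_apply]
  simp only [reflectHalfSpace, he, real_inner_comm e x]
  simp
  module

lemma reflectHalfSpace_mp (he : ‖e‖ = 1) :
    MeasurePreserving (reflectHalfSpace e c) volume volume := by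
  have h : reflectHalfSpace e c =
      (fun z => z + (2 * c) • e) ∘ (fun x => (ℝ ∙ e)ᗮ.reflection x) := by
    funext x; exact reflectHalfSpace_eq e c he x
  rw [h]
  exact (measurePreserving_add_right volume ((2 * c) • e)).comp
    ((ℝ ∙ e)ᗮ.reflection.measurePreserving)

lemma reflectHalfSpace_norm (he : ‖e‖ = 1) (x y : EuclideanSpace ℝ (Fin N)) :
    ‖reflectHalfSpace e c x - reflectHalfSpace e c y‖ = ‖x - y‖ := by
  rw [reflectHalfSpace_eq e c he, reflectHalfSpace_eq e c he, add_sub_add_right_eq_sub,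
    ← map_sub, LinearIsometryEquiv.norm_map]

lemma reflectHalfSpace_norm_left (he : ‖e‖ = 1) (x y : EuclideanSpace ℝ (Fin N)) :
    ‖reflectHalfSpace e c x - y‖ = ‖x - reflectHalfSpace e c y‖ := by
  rw [← reflectHalfSpace_norm e c he x, reflectHalfSpace_invol e c he]

lemma reflectHalfSpace_norm_sq (he : ‖e‖ = 1) (x y : EuclideanSpace ℝ (Fin N)) :
    ‖x - reflectHalfSpace e c y‖ ^ 2 = ‖x - y‖ ^ 2 + 4 * ((⟪x, e⟫ - c) * (⟪y, e⟫ - c)) := by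
  have : x - reflectHalfSpace e c y = (x - y) + (2 * (⟪y, e⟫ - c)) • e := by
    simp only [reflectHalfSpace]; module
  rw [this, norm_add_sq_real, norm_smul, he, real_inner_smul_right, inner_sub_left]
  simp only [Real.norm_eq_abs, mul_one, sq_abs]
  ring

lemma lintegral_four {Φ : EuclideanSpace ℝ (Fin N) → EuclideanSpace ℝ (Fin N) → ENNReal}
    (he : ‖e‖ = 1) (hΦ : Measurable (Function.uncurry Φ)) :
    4 * ∫⁻ x, ∫⁻ y, Φ x y = ∫⁻ x, ∫⁻ y, (Φ x y + Φ (reflectHalfSpace e c x) (reflectHalfSpace e c y)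
      + (Φ (reflectHalfSpace e c x) y + Φ x (reflectHalfSpace e c y))) := by
  set σ := reflectHalfSpace e c with hσ
  have mp : MeasurePreserving σ volume volume := reflectHalfSpace_mp e c he
  have mσ : Measurable σ := mp.measurable
  have inner : ∀ x, ∫⁻ y, (Φ x y + Φ (σ x) (σ y) + (Φ (σ x) y + Φ x (σ y)))
      = 2 * (∫⁻ y, Φ x y) + 2 * ∫⁻ y, Φ (σ x) y := by
    intro x
    have m : ∀ x, Measurable (Φ x) := fun x => hΦ.of_uncurry_left
    have m' : ∀ x, Measurable fun y => Φ x (σ y) := fun x => (m x).comp mσ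
    have m2 : Measurable fun y => Φ x y + Φ (σ x) (σ y) := (m x).add (m' (σ x))
    rw [lintegral_add_left m2, lintegral_add_left (m x),
      lintegral_add_left (m (σ x)), mp.lintegral_comp (m (σ x)), mp.lintegral_comp (m x)]
    ring
  have mI : Measurable fun x => ∫⁻ y, Φ x y := hΦ.lintegral_prod_right'
  have mJ : Measurable fun x => ∫⁻ y, Φ (σ x) y := mI.comp mσ
  have hJ : ∫⁻ x, ∫⁻ y, Φ (σ x) y = ∫⁻ x, ∫⁻ y, Φ x y := mp.lintegral_comp mI
  simp_rw [inner]
  rw [lintegral_add_left (mI.const_mul 2), lintegral_const_mul _ mI,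
    lintegral_const_mul _ mJ, hJ]
  ring

lemma polarization_measurable (he : ‖e‖ = 1) {u : EuclideanSpace ℝ (Fin N) → ℝ}
    (hu : Measurable u) : Measurable (polarization e c u) := by
  have mσ := (reflectHalfSpace_mp e c he).measurable
  unfold polarization
  refine Measurable.ite ?_ (hu.max (hu.comp mσ)) (hu.min (hu.comp mσ))
  exact measurableSet_le measurable_const (by fun_prop)

lemma pol_pos (he : ‖e‖ = 1) (u : EuclideanSpace ℝ (Fin N) → ℝ) {F : ℝ → ℝ} (hF : Monotone F)
    {x : EuclideanSpace ℝ (Fin N)} (h : c ≤ ⟪x, e⟫) :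
    F (polarization e c u x) = max (F (u x)) (F (u (reflectHalfSpace e c x))) ∧
    F (polarization e c u (reflectHalfSpace e c x)) =
      min (F (u x)) (F (u (reflectHalfSpace e c x))) := by
  refine ⟨by rw [polarization, if_pos h, hF.map_max], ?_⟩
  rw [polarization, reflectHalfSpace_inner e c he, reflectHalfSpace_invol e c he]
  split_ifs with h2
  · have h3 : ⟪x, e⟫ = c := by linarith
    have : reflectHalfSpace e c x = x := by simp [reflectHalfSpace, h3]
    simp [this]
  · rw [hF.map_min, min_comm]

lemma pol_neg (he : ‖e‖ = 1) (u : EuclideanSpace ℝ (Fin N) → ℝ) {F : ℝ → ℝ} (hF : Monotone F)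
    {x : EuclideanSpace ℝ (Fin N)} (h : ⟪x, e⟫ ≤ c) :
    F (polarization e c u x) = min (F (u x)) (F (u (reflectHalfSpace e c x))) ∧
    F (polarization e c u (reflectHalfSpace e c x)) =
      max (F (u x)) (F (u (reflectHalfSpace e c x))) := by
  have h' : c ≤ ⟪reflectHalfSpace e c x, e⟫ := by
    rw [reflectHalfSpace_inner e c he]; linarith
  have := pol_pos e c he u hF h'
  rw [reflectHalfSpace_invol e c he] at this
  exact ⟨by rw [this.2, min_comm], by rw [this.1, max_comm]⟩

lemma kernel_le {μ a b : ℝ} (hμ : 0 < μ) (ha : 0 < a) (hab : a ^ 2 ≤ b ^ 2) (hb : 0 ≤ b) :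
    (b ^ μ)⁻¹ ≤ (a ^ μ)⁻¹ := by
  have : a ≤ b := by nlinarith
  have := Real.rpow_le_rpow ha.le this hμ.le
  have := Real.rpow_pos_of_pos ha μ
  gcongr

lemma real_ineq (he : ‖e‖ = 1) (u : EuclideanSpace ℝ (Fin N) → ℝ) {F : ℝ → ℝ} (hF : Monotone F)
    {μ : ℝ} (hμ : 0 < μ) {x y : EuclideanSpace ℝ (Fin N)} (h1 : x ≠ y)
    (h2 : x ≠ reflectHalfSpace e c y) (A B : ℝ) (hA : A = (‖x - y‖ ^ μ)⁻¹)
    (hB : B = (‖x - reflectHalfSpace e c y‖ ^ μ)⁻¹)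
    (G : EuclideanSpace ℝ (Fin N) → ℝ) (hG : G = fun x => F (polarization e c u x))
    (f : EuclideanSpace ℝ (Fin N) → ℝ) (hf : f = fun x => F (u x)) :
    A * (f x * f y + f (reflectHalfSpace e c x) * f (reflectHalfSpace e c y)) +
      B * (f (reflectHalfSpace e c x) * f y + f x * f (reflectHalfSpace e c y)) ≤
    A * (G x * G y + G (reflectHalfSpace e c x) * G (reflectHalfSpace e c y)) +
      B * (G (reflectHalfSpace e c x) * G y + G x * G (reflectHalfSpace e c y)) := by
  have p1 : 0 < ‖x - y‖ := norm_pos_iff.2 (sub_ne_zero.2 h1)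
  have p2 : 0 < ‖x - reflectHalfSpace e c y‖ := norm_pos_iff.2 (sub_ne_zero.2 h2)
  have hn := reflectHalfSpace_norm_sq e c he x y
  have hBA : 0 ≤ (⟪x, e⟫ - c) * (⟪y, e⟫ - c) → B ≤ A := fun h => by
    rw [hA, hB]; exact kernel_le hμ p1 (by linarith) p2.le
  have hAB : (⟪x, e⟫ - c) * (⟪y, e⟫ - c) ≤ 0 → A ≤ B := fun h => by
    rw [hA, hB]; exact kernel_le hμ p2 (by linarith) p1.le
  subst hG hf
  beta_reduce
  rcases le_total c ⟪x, e⟫ with hx | hx <;> rcases le_total c ⟪y, e⟫ with hy | hy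
  · rw [(pol_pos e c he u hF hx).1, (pol_pos e c he u hF hx).2, (pol_pos e c he u hF hy).1,
      (pol_pos e c he u hF hy).2]
    exact four_point _ _ _ _ _ _ (hBA (by nlinarith))
  · rw [(pol_pos e c he u hF hx).1, (pol_pos e c he u hF hx).2, (pol_neg e c he u hF hy).1,
      (pol_neg e c he u hF hy).2]
    have := four_point _ _ (F (u x)) (F (u (reflectHalfSpace e c x))) (F (u y))
      (F (u (reflectHalfSpace e c y))) (hAB (by nlinarith))
    have := four_point _ _ (F (u (reflectHalfSpace e c x))) (F (u x)) (F (u y))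
      (F (u (reflectHalfSpace e c y))) (hAB (by nlinarith))
    rw [max_comm (F (u (reflectHalfSpace e c x))), min_comm (F (u (reflectHalfSpace e c x)))] at this
    linarith
  · rw [(pol_neg e c he u hF hx).1, (pol_neg e c he u hF hx).2, (pol_pos e c he u hF hy).1,
      (pol_pos e c he u hF hy).2]
    have := four_point _ _ (F (u (reflectHalfSpace e c x))) (F (u x)) (F (u y))
      (F (u (reflectHalfSpace e c y))) (hAB (by nlinarith))
    rw [max_comm (F (u (reflectHalfSpace e c x))), min_comm (F (u (reflectHalfSpace e c x)))] at this
    linarith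
  · rw [(pol_neg e c he u hF hx).1, (pol_neg e c he u hF hx).2, (pol_neg e c he u hF hy).1,
      (pol_neg e c he u hF hy).2]
    have := four_point _ _ (F (u x)) (F (u (reflectHalfSpace e c x))) (F (u y))
      (F (u (reflectHalfSpace e c y))) (hBA (by nlinarith))
    linarith

/-- Rewriting the four-term sum as one `ofReal`. -/
lemma sum_four (he : ‖e‖ = 1) {μ : ℝ} (f : EuclideanSpace ℝ (Fin N) → ℝ) (hf : ∀ x, 0 ≤ f x)
    (x y : EuclideanSpace ℝ (Fin N)) :
    ENNReal.ofReal (f x * f y / ‖x - y‖ ^ μ) +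
      ENNReal.ofReal (f (reflectHalfSpace e c x) * f (reflectHalfSpace e c y) /
        ‖reflectHalfSpace e c x - reflectHalfSpace e c y‖ ^ μ) +
      (ENNReal.ofReal (f (reflectHalfSpace e c x) * f y / ‖reflectHalfSpace e c x - y‖ ^ μ) +
       ENNReal.ofReal (f x * f (reflectHalfSpace e c y) / ‖x - reflectHalfSpace e c y‖ ^ μ)) =
    ENNReal.ofReal ((‖x - y‖ ^ μ)⁻¹ *
        (f x * f y + f (reflectHalfSpace e c x) * f (reflectHalfSpace e c y)) +
      (‖x - reflectHalfSpace e c y‖ ^ μ)⁻¹ *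
        (f (reflectHalfSpace e c x) * f y + f x * f (reflectHalfSpace e c y))) := by
  have nn : ∀ a b : EuclideanSpace ℝ (Fin N), ∀ t : ℝ, 0 ≤ t → 0 ≤ f a * f b / t ^ μ :=
    fun a b t ht => div_nonneg (mul_nonneg (hf a) (hf b)) (Real.rpow_nonneg ht μ)
  rw [reflectHalfSpace_norm e c he, reflectHalfSpace_norm_left e c he]
  rw [← ENNReal.ofReal_add (nn _ _ _ (norm_nonneg _)) (nn _ _ _ (norm_nonneg _)),
    ← ENNReal.ofReal_add (nn _ _ _ (norm_nonneg _)) (nn _ _ _ (norm_nonneg _)),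
    ← ENNReal.ofReal_add (add_nonneg (nn _ _ _ (norm_nonneg _)) (nn _ _ _ (norm_nonneg _)))
      (add_nonneg (nn _ _ _ (norm_nonneg _)) (nn _ _ _ (norm_nonneg _)))]
  congr 1
  ring

lemma meas_integrand (μ : ℝ) {f : EuclideanSpace ℝ (Fin N) → ℝ} (hf : Measurable f) :
    Measurable (Function.uncurry fun x y : EuclideanSpace ℝ (Fin N) =>
      ENNReal.ofReal (f x * f y / ‖x - y‖ ^ μ)) := by
  unfold Function.uncurry
  fun_prop

end aux

/-- Polarization increases the Riesz–Choquard energy of `F ∘ u` when `F` is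
nondecreasing and vanishes on `(-∞, 0]`. -/
theorem polarization_choquard_le (N : ℕ) (hN : 1 ≤ N) (μ : ℝ)
    (hμ0 : 0 < μ) (hμN : μ < N)
    (e : EuclideanSpace ℝ (Fin N)) (he : ‖e‖ = 1) (c : ℝ)
    (u : EuclideanSpace ℝ (Fin N) → ℝ) (hu : Measurable u)
    (F : ℝ → ℝ) (hmono : Monotone F) (hF0 : ∀ t : ℝ, t ≤ 0 → F t = 0) :
    (∫⁻ x, ∫⁻ y, ENNReal.ofReal (F (u x) * F (u y) / ‖x - y‖ ^ μ)) ≤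
      ∫⁻ x, ∫⁻ y, ENNReal.ofReal
        (F (polarization e c u x) * F (polarization e c u y) / ‖x - y‖ ^ μ) := by
  have hFn : ∀ t, 0 ≤ F t := fun t => by
    rw [← hF0 (min t 0) (min_le_right _ _)]; exact hmono (min_le_left _ _)
  have m1 := meas_integrand μ (hmono.measurable.comp hu)
  have m2 := meas_integrand μ (hmono.measurable.comp (polarization_measurable e c he hu))
  have hnt : Nontrivial (EuclideanSpace ℝ (Fin N)) :=
    ⟨e, 0, fun h => by simp [h] at he⟩
  have key := lintegral_four e c he m1
  have key2 := lintegral_four e c he m2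
  simp only [Function.comp_apply] at key key2
  rw [← ENNReal.mul_le_mul_iff_right (a := 4) (by norm_num) (by norm_num), key, key2]
  refine lintegral_mono fun x => lintegral_mono_ae ?_
  have a1 : ∀ᵐ y : EuclideanSpace ℝ (Fin N), y ≠ x := Measure.ae_ne volume x
  have a2 : ∀ᵐ y : EuclideanSpace ℝ (Fin N), y ≠ reflectHalfSpace e c x :=
    Measure.ae_ne volume _
  filter_upwards [a1, a2] with y h1 h2
  have h3 : x ≠ reflectHalfSpace e c y := fun h => h2 (by
    rw [h, reflectHalfSpace_invol e c he])
  have s1 := sum_four (μ := μ) e c he (fun x => F (u x)) (fun x => hFn _) x y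
  have s2 := sum_four (μ := μ) e c he (fun x => F (polarization e c u x)) (fun x => hFn _) x y
  beta_reduce at s1 s2
  rw [s1, s2]
  exact ENNReal.ofReal_le_ofReal
    (real_ineq e c he u hmono hμ0 h1.symm h3 _ _ rfl rfl _ rfl _ rfl)
end

section
/- Let N ≥ 1, V∞ > 0, κ > 0, and let V : ℝ^N → ℝ be twice continuously differentiable. Assume (V3): N·V(z) + ⟨∇V(z), z⟩ ≥ N·V∞ for all z ∈ ℝ^N, and (V4): N·⟨∇V(z), z⟩ + D²V(z)(z,z) ≤ 0 for all z ∈ ℝ^N. Then for every fixed x ∈ ℝ^N, the function t ↦ t^{−κ}·(N·V(t·x) + ⟨∇V(t·x), t·x⟩) is nonincreasing on (0, ∞). -/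
open RealInnerProductSpace

/-- Under (V3) and (V4), the function
`t ↦ t^{-κ}(N·V(tx) + ⟨∇V(tx), tx⟩)` is nonincreasing on `(0, ∞)`. -/
theorem psi_antitone (N : ℕ) (hN : 1 ≤ N) (Vinf κ : ℝ) (hVinf : 0 < Vinf) (hκ : 0 < κ)
    (V : EuclideanSpace ℝ (Fin N) → ℝ) (hV : ContDiff ℝ 2 V)
    (hV3 : ∀ z : EuclideanSpace ℝ (Fin N),
      (N : ℝ) * Vinf ≤ (N : ℝ) * V z + ⟪gradient V z, z⟫)
    (hV4 : ∀ z : EuclideanSpace ℝ (Fin N),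
      (N : ℝ) * ⟪gradient V z, z⟫ + fderiv ℝ (fderiv ℝ V) z z z ≤ 0) :
    ∀ x : EuclideanSpace ℝ (Fin N),
      AntitoneOn
        (fun t : ℝ => t ^ (-κ) * ((N : ℝ) * V (t • x) + ⟪gradient V (t • x), t • x⟫))
        (Set.Ioi 0) := by
  intro x
  have hin : ∀ z w : EuclideanSpace ℝ (Fin N), ⟪gradient V z, w⟫ = fderiv ℝ V z w := by
    intro z w
    simp [gradient]
  simp only [hin] at hV3 hV4 ⊢
  have hline : ∀ t : ℝ, HasDerivAt (fun s : ℝ => s • x) x t := by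
    intro t
    simpa using (hasDerivAt_id t).smul_const x
  have hVd : Differentiable ℝ V := hV.differentiable (by norm_num)
  have hV1 : ContDiff ℝ 1 (fderiv ℝ V) := hV.fderiv_right (by norm_num)
  have hFd : Differentiable ℝ (fderiv ℝ V) := hV1.differentiable (by norm_num)
  have hg : ∀ t : ℝ, HasDerivAt (fun s : ℝ => V (s • x)) (fderiv ℝ V (t • x) x) t := by
    intro t
    exact (hVd (t • x)).hasFDerivAt.comp_hasDerivAt t (hline t)
  have hg1 : ∀ t : ℝ, HasDerivAt (fun s : ℝ => fderiv ℝ V (s • x) x)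
      (fderiv ℝ (fderiv ℝ V) (t • x) x x) t := by
    intro t
    have h := (hFd (t • x)).hasFDerivAt.comp_hasDerivAt t (hline t)
    simpa using h.clm_apply (hasDerivAt_const t x)
  have h4 : ∀ t : ℝ, 0 < t → (N : ℝ) * fderiv ℝ V (t • x) x
      + t * fderiv ℝ (fderiv ℝ V) (t • x) x x ≤ 0 := by
    intro t ht
    have h := hV4 (t • x)
    simp only [map_smul, smul_eq_mul, ContinuousLinearMap.smul_apply] at h
    by_contra hc
    push Not at hc
    nlinarith [mul_pos ht hc]
  have hh : ∀ t : ℝ, HasDerivAt (fun s : ℝ => s ^ N * fderiv ℝ V (s • x) x)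
      ((N : ℝ) * t ^ (N - 1) * fderiv ℝ V (t • x) x
        + t ^ N * fderiv ℝ (fderiv ℝ V) (t • x) x x) t := by
    intro t
    exact (hasDerivAt_pow N t).mul (hg1 t)
  have hanti : AntitoneOn (fun s : ℝ => s ^ N * fderiv ℝ V (s • x) x) (Set.Ici 0) := by
    apply antitoneOn_of_deriv_nonpos (convex_Ici 0)
    · exact fun t _ => (hh t).continuousAt.continuousWithinAt
    · exact fun t _ => (hh t).differentiableAt.differentiableWithinAt
    · intro t ht
      rw [interior_Ici] at ht
      have ht : 0 < t := ht
      rw [(hh t).deriv]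
      have e : t ^ N = t ^ (N - 1) * t := by
        rw [← pow_succ, Nat.sub_add_cancel hN]
      have := mul_nonpos_of_nonneg_of_nonpos (pow_pos ht (N - 1)).le (h4 t ht)
      rw [e]
      linarith
  have hneg : ∀ t : ℝ, 0 < t → fderiv ℝ V (t • x) x ≤ 0 := by
    intro t ht
    have h := hanti (Set.mem_Ici.2 le_rfl) (Set.mem_Ici.2 ht.le) ht.le
    have hN0 : N ≠ 0 := by omega
    simp only [zero_pow hN0, zero_mul] at h
    have hp := pow_pos ht N
    by_contra hc
    push Not at hc
    linarith [mul_pos hp hc]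
  have hf : ∀ t : ℝ, HasDerivAt
      (fun t : ℝ => (N : ℝ) * V (t • x) + fderiv ℝ V (t • x) (t • x))
      ((N : ℝ) * fderiv ℝ V (t • x) x + (1 * fderiv ℝ V (t • x) x
        + t * fderiv ℝ (fderiv ℝ V) (t • x) x x)) t := by
    intro t
    simp only [map_smul, smul_eq_mul]
    exact ((hg t).const_mul (N : ℝ)).add ((hasDerivAt_id' t).mul (hg1 t))
  have hfanti : AntitoneOn
      (fun t : ℝ => (N : ℝ) * V (t • x) + fderiv ℝ V (t • x) (t • x)) (Set.Ioi 0) := by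
    apply antitoneOn_of_deriv_nonpos (convex_Ioi 0)
    · exact fun t _ => (hf t).continuousAt.continuousWithinAt
    · exact fun t _ => (hf t).differentiableAt.differentiableWithinAt
    · intro t ht
      rw [interior_Ioi] at ht
      rw [(hf t).deriv]
      linarith [h4 t ht, hneg t ht]
  intro a ha b hb hab
  have ha' : 0 < a := ha
  have hb' : 0 < b := hb
  apply mul_le_mul
  · exact Real.rpow_le_rpow_of_nonpos ha' hab (by linarith)
  · exact hfanti ha hb hab
  · exact le_trans (by positivity) (hV3 (b • x))
  · positivity
end

section
/- Let 1 < p < N, 0 < μ < N, 1 ≤ θ ≤ N/(N−p), let c₁, c₂, c₃ > 0, and let φ : (0, ∞) → ℝ be nonincreasing. Then there is at most one t > 0 satisfying c₁·t^{N−p} + c₂·t^{(N−p)θ} + t^{N}·φ(t) = c₃·t^{2N−μ}. -/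
/-- Abstract uniqueness of the Poho\v{z}aev projection: for
`1 ≤ θ ≤ N/(N-p)` and a nonincreasing `φ`, the equation
`c₁ t^{N-p} + c₂ t^{(N-p)θ} + t^N φ(t) = c₃ t^{2N-μ}` has at most one positive
solution. -/
theorem pohozaev_projection_unique (N : ℕ) (p μ θ : ℝ)
    (hp : 1 < p) (hpN : p < N) (hμ0 : 0 < μ) (hμN : μ < N)
    (hθ1 : 1 ≤ θ) (hθ2 : θ ≤ (N : ℝ) / (N - p))
    (c₁ c₂ c₃ : ℝ) (hc₁ : 0 < c₁) (hc₂ : 0 < c₂) (hc₃ : 0 < c₃)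
    (φ : ℝ → ℝ) (hφ : AntitoneOn φ (Set.Ioi 0)) :
    ∀ t₁ t₂ : ℝ, 0 < t₁ → 0 < t₂ →
      c₁ * t₁ ^ ((N : ℝ) - p) + c₂ * t₁ ^ (((N : ℝ) - p) * θ) + t₁ ^ (N : ℝ) * φ t₁
        = c₃ * t₁ ^ (2 * (N : ℝ) - μ) →
      c₁ * t₂ ^ ((N : ℝ) - p) + c₂ * t₂ ^ (((N : ℝ) - p) * θ) + t₂ ^ (N : ℝ) * φ t₂
        = c₃ * t₂ ^ (2 * (N : ℝ) - μ) →
      t₁ = t₂ := by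
  have hNp : (0 : ℝ) < N - p := by linarith
  have hθ : ((N : ℝ) - p) * θ ≤ N := by
    rw [le_div_iff₀ hNp] at hθ2
    linarith
  have red : ∀ t : ℝ, 0 < t →
      c₁ * t ^ ((N : ℝ) - p) + c₂ * t ^ (((N : ℝ) - p) * θ) + t ^ (N : ℝ) * φ t
        = c₃ * t ^ (2 * (N : ℝ) - μ) →
      c₁ * t ^ (-p) + c₂ * t ^ (((N : ℝ) - p) * θ - N) + φ t = c₃ * t ^ ((N : ℝ) - μ) := by
    intro t ht h
    have e1 : t ^ ((N : ℝ) - p) = t ^ (N : ℝ) * t ^ (-p) := by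
      rw [← Real.rpow_add ht]; ring_nf
    have e2 : t ^ (((N : ℝ) - p) * θ) = t ^ (N : ℝ) * t ^ (((N : ℝ) - p) * θ - N) := by
      rw [← Real.rpow_add ht]; ring_nf
    have e3 : t ^ (2 * (N : ℝ) - μ) = t ^ (N : ℝ) * t ^ ((N : ℝ) - μ) := by
      rw [← Real.rpow_add ht]; ring_nf
    rw [e1, e2, e3] at h
    have hpos : t ^ (N : ℝ) ≠ 0 := (Real.rpow_pos_of_pos ht _).ne'
    apply mul_left_cancel₀ hpos
    linear_combination h
  have key : ∀ s t : ℝ, 0 < s → s < t →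
      c₁ * s ^ (-p) + c₂ * s ^ (((N : ℝ) - p) * θ - N) + φ s = c₃ * s ^ ((N : ℝ) - μ) →
      c₁ * t ^ (-p) + c₂ * t ^ (((N : ℝ) - p) * θ - N) + φ t = c₃ * t ^ ((N : ℝ) - μ) →
      False := by
    intro s t hs hst h1 h2
    have a1 : t ^ (-p) ≤ s ^ (-p) :=
      Real.rpow_le_rpow_of_nonpos hs hst.le (by linarith)
    have a2 : t ^ (((N : ℝ) - p) * θ - N) ≤ s ^ (((N : ℝ) - p) * θ - N) :=
      Real.rpow_le_rpow_of_nonpos hs hst.le (by linarith)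
    have a3 : s ^ ((N : ℝ) - μ) < t ^ ((N : ℝ) - μ) :=
      Real.rpow_lt_rpow hs.le hst (by linarith)
    have a4 : φ t ≤ φ s := hφ hs (hs.trans hst) hst.le
    have b1 := mul_le_mul_of_nonneg_left a1 hc₁.le
    have b2 := mul_le_mul_of_nonneg_left a2 hc₂.le
    have b3 := mul_lt_mul_of_pos_left a3 hc₃
    linarith
  intro t₁ t₂ h₁ h₂ e₁ e₂
  rcases lt_trichotomy t₁ t₂ with h | h | h
  · exact (key t₁ t₂ h₁ h (red t₁ h₁ e₁) (red t₂ h₂ e₂)).elim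
  · exact h
  · exact (key t₂ t₁ h₂ h (red t₂ h₂ e₂) (red t₁ h₁ e₁)).elim
end

section
/- Let 1 < p < N, 0 < μ < N, a, b > 0, 1 ≤ θ < (2N−μ)/(N−p), and V∞ > 0. Let V : ℝ^N → ℝ be differentiable with ⟨∇V(x), x⟩ ≤ 0 and N·V(x) + ⟨∇V(x), x⟩ ≥ N·V∞ for all x ∈ ℝ^N. Let u : ℝ^N → ℝ be differentiable, and assume X := ∫‖∇u‖^p < ∞, Y := ∫|u|^p < ∞, and that the functions x ↦ V(x)|u(x)|^p and x ↦ ⟨∇V(x), x⟩|u(x)|^p are Lebesgue integrable. For any real number D, define J := (a/p)X + (b/(pθ))X^θ + (1/p)∫V(x)|u|^p − D/2 and P := ((N−p)a/p)X + ((N−p)b/p)X^θ + (1/p)∫(N·V(x) + ⟨∇V(x),x⟩)|u|^p − ((2N−μ)/2)·D. Then J − P/(2N−μ) ≥ c(X + Y), where c := min{ a(N−μ+p)/(p(2N−μ)), (N−μ)V∞/(p(2N−μ)) } > 0. -/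
open MeasureTheory RealInnerProductSpace

/-- Coercivity estimate `J - P/(2N-μ) ≥ c(X + Y)` for the energy and
Poho\v{z}aev functionals of the `p`-Kirchhoff–Choquard problem. -/
theorem energy_minus_pohozaev_coercive (N : ℕ) (p μ a b θ Vinf : ℝ)
    (hp : 1 < p) (hpN : p < N) (hμ0 : 0 < μ) (hμN : μ < N)
    (ha : 0 < a) (hb : 0 < b) (hθ1 : 1 ≤ θ) (hθ2 : θ < (2 * N - μ) / (N - p))
    (hVinf : 0 < Vinf)
    (V : EuclideanSpace ℝ (Fin N) → ℝ) (hVdiff : Differentiable ℝ V)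
    (hV2 : ∀ x, ⟪gradient V x, x⟫ ≤ 0)
    (hV3 : ∀ x, (N : ℝ) * Vinf ≤ (N : ℝ) * V x + ⟪gradient V x, x⟫)
    (u : EuclideanSpace ℝ (Fin N) → ℝ) (hu : Differentiable ℝ u)
    (hX : Integrable (fun x => ‖fderiv ℝ u x‖ ^ p))
    (hY : Integrable (fun x => |u x| ^ p))
    (hVI : Integrable (fun x => V x * |u x| ^ p))
    (hGI : Integrable (fun x => ⟪gradient V x, x⟫ * |u x| ^ p))
    (D : ℝ) :
    0 < min (a * ((N : ℝ) - μ + p) / (p * (2 * N - μ)))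
        (((N : ℝ) - μ) * Vinf / (p * (2 * N - μ))) ∧
      min (a * ((N : ℝ) - μ + p) / (p * (2 * N - μ)))
          (((N : ℝ) - μ) * Vinf / (p * (2 * N - μ)))
        * ((∫ x, ‖fderiv ℝ u x‖ ^ p) + (∫ x, |u x| ^ p)) ≤
        ((a / p) * (∫ x, ‖fderiv ℝ u x‖ ^ p)
            + (b / (p * θ)) * (∫ x, ‖fderiv ℝ u x‖ ^ p) ^ θ
            + (1 / p) * (∫ x, V x * |u x| ^ p) - D / 2)
          - ((((N : ℝ) - p) * a / p) * (∫ x, ‖fderiv ℝ u x‖ ^ p)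
              + (((N : ℝ) - p) * b / p) * (∫ x, ‖fderiv ℝ u x‖ ^ p) ^ θ
              + (1 / p) * (∫ x, ((N : ℝ) * V x + ⟪gradient V x, x⟫) * |u x| ^ p)
              - ((2 * N - μ) / 2) * D) / (2 * N - μ) := by
  have hN : (0 : ℝ) < N := by linarith
  have hM : (0 : ℝ) < 2 * N - μ := by linarith
  have hp0 : 0 < p := by linarith
  have hθ0 : 0 < θ := by linarith
  have hNp : (0 : ℝ) < N - p := by linarith
  have hNμ : (0 : ℝ) < N - μ := by linarith
  have hVge : ∀ x, Vinf ≤ V x := by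
    intro x
    have h1 := hV2 x
    have h2 := hV3 x
    have h3 : (N : ℝ) * Vinf ≤ N * V x := by linarith
    exact le_of_mul_le_mul_left h3 hN
  have hG : (∫ x, ⟪gradient V x, x⟫ * |u x| ^ p) ≤ 0 :=
    integral_nonpos fun x =>
      mul_nonpos_of_nonpos_of_nonneg (hV2 x) (Real.rpow_nonneg (abs_nonneg _) _)
  have hIV : Vinf * (∫ x, |u x| ^ p) ≤ ∫ x, V x * |u x| ^ p := by
    rw [← integral_const_mul]
    exact integral_mono (hY.const_mul _) hVI fun x =>
      mul_le_mul_of_nonneg_right (hVge x) (Real.rpow_nonneg (abs_nonneg _) _)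
  have hsum : (∫ x, ((N : ℝ) * V x + ⟪gradient V x, x⟫) * |u x| ^ p)
      = N * (∫ x, V x * |u x| ^ p) + ∫ x, ⟪gradient V x, x⟫ * |u x| ^ p := by
    rw [← integral_const_mul, ← integral_add (hVI.const_mul _) hGI]
    congr 1
    ext x
    ring
  have hX0 : 0 ≤ ∫ x, ‖fderiv ℝ u x‖ ^ p :=
    integral_nonneg fun x => Real.rpow_nonneg (norm_nonneg _) _
  have hY0 : 0 ≤ ∫ x, |u x| ^ p :=
    integral_nonneg fun x => Real.rpow_nonneg (abs_nonneg _) _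
  have hT0 := Real.rpow_nonneg hX0 θ
  rw [hsum]
  generalize (∫ x, ‖fderiv ℝ u x‖ ^ p) = X at *
  generalize (∫ x, |u x| ^ p) = Y at *
  generalize (∫ x, V x * |u x| ^ p) = W at *
  generalize (∫ x, ⟪gradient V x, x⟫ * |u x| ^ p) = G at *
  generalize X ^ θ = T at *
  have hθM : 0 ≤ (2 * N - μ) - θ * (N - p) := by
    rw [lt_div_iff₀ hNp] at hθ2
    linarith
  constructor
  · apply lt_min
    · have : (0 : ℝ) < N - μ + p := by linarith
      positivity
    · positivity
  have e1 := mul_le_mul_of_nonneg_right (min_le_left (a * ((N : ℝ) - μ + p) / (p * (2 * N - μ)))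
        (((N : ℝ) - μ) * Vinf / (p * (2 * N - μ)))) hX0
  have e2 := mul_le_mul_of_nonneg_right (min_le_right (a * ((N : ℝ) - μ + p) / (p * (2 * N - μ)))
        (((N : ℝ) - μ) * Vinf / (p * (2 * N - μ)))) hY0
  have k1 : 0 ≤ b * T * ((2 * N - μ) - θ * (N - p)) / (p * θ * (2 * N - μ)) := by positivity
  have k2 : 0 ≤ ((N - μ) * (W - Vinf * Y) - G) / (p * (2 * N - μ)) := by
    have := mul_nonneg hNμ.le (sub_nonneg.2 hIV)
    apply div_nonneg _ (by positivity)
    linarith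
  rw [mul_add]
  refine (add_le_add e1 e2).trans ?_
  rw [← sub_nonneg]
  refine (add_nonneg k1 k2).trans_eq ?_
  field_simp
  ring
end

section
/- Let N ≥ 1 be an integer, 0 < μ < N, V∞ > 0, and let V : ℝ^N → ℝ be twice continuously differentiable satisfying, for all z ∈ ℝ^N: ⟨∇V(z), z⟩ ≤ 0; N·V(z) + ⟨∇V(z), z⟩ ≥ N·V∞; and N·⟨∇V(z), z⟩ + D²V(z)(z,z) ≤ 0. Then for every fixed x ∈ ℝ^N, the function t ↦ t^{N}·((N−μ)·V(t·x) − ⟨∇V(t·x), t·x⟩) is nondecreasing on (0, ∞). -/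
open RealInnerProductSpace

/-- Under (V2), (V3) and (V4), the function
`t ↦ t^N((N-μ)V(tx) - ⟨∇V(tx), tx⟩)` is nondecreasing on `(0, ∞)`. -/
theorem g_monotone (N : ℕ) (hN : 1 ≤ N) (μ Vinf : ℝ)
    (hμ0 : 0 < μ) (hμN : μ < N) (hVinf : 0 < Vinf)
    (V : EuclideanSpace ℝ (Fin N) → ℝ) (hV : ContDiff ℝ 2 V)
    (hV2 : ∀ z : EuclideanSpace ℝ (Fin N), ⟪gradient V z, z⟫ ≤ 0)
    (hV3 : ∀ z : EuclideanSpace ℝ (Fin N),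
      (N : ℝ) * Vinf ≤ (N : ℝ) * V z + ⟪gradient V z, z⟫)
    (hV4 : ∀ z : EuclideanSpace ℝ (Fin N),
      (N : ℝ) * ⟪gradient V z, z⟫ + fderiv ℝ (fderiv ℝ V) z z z ≤ 0) :
    ∀ x : EuclideanSpace ℝ (Fin N),
      MonotoneOn
        (fun t : ℝ =>
          t ^ (N : ℝ) * (((N : ℝ) - μ) * V (t • x) - ⟪gradient V (t • x), t • x⟫))
        (Set.Ioi 0) := by
  intro x
  have hg : ∀ z y : EuclideanSpace ℝ (Fin N), ⟪gradient V z, y⟫ = fderiv ℝ V z y := by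
    intro z y
    simp [gradient]
  simp only [hg, Real.rpow_natCast] at *
  have hVd : ∀ z, HasFDerivAt V (fderiv ℝ V z) z := fun z =>
    (hV.differentiable (by norm_num) z).hasFDerivAt
  have hDd : ∀ z, HasFDerivAt (fderiv ℝ V) (fderiv ℝ (fderiv ℝ V) z) z := fun z =>
    ((hV.fderiv_right (m := 1) (by norm_num)).differentiable (by norm_num) z).hasFDerivAt
  have hl : ∀ t : ℝ, HasDerivAt (fun t : ℝ => t • x) x t := fun t => by
    simpa using (hasDerivAt_id t).smul_const x
  have h1 : ∀ t : ℝ, HasDerivAt (fun t : ℝ => V (t • x)) (fderiv ℝ V (t • x) x) t := fun t =>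
    (hVd (t • x)).comp_hasDerivAt t (hl t)
  have h2 : ∀ t : ℝ, HasDerivAt (fun t : ℝ => fderiv ℝ V (t • x))
      (fderiv ℝ (fderiv ℝ V) (t • x) x) t := fun t =>
    (hDd (t • x)).comp_hasDerivAt t (hl t)
  have h3 : ∀ t : ℝ, HasDerivAt (fun t : ℝ => fderiv ℝ V (t • x) (t • x))
      (fderiv ℝ (fderiv ℝ V) (t • x) x (t • x) + fderiv ℝ V (t • x) x) t := fun t =>
    (h2 t).clm_apply (hl t)
  have h4 := fun t : ℝ =>
    (hasDerivAt_pow N t).mul (((h1 t).const_mul ((N : ℝ) - μ)).sub (h3 t))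
  refine monotoneOn_of_deriv_nonneg (convex_Ioi 0)
    (fun t _ => (h4 t).continuousAt.continuousWithinAt)
    (fun t _ => (h4 t).differentiableAt.differentiableWithinAt) ?_
  intro t ht
  rw [interior_Ioi] at ht
  have ht : 0 < t := ht
  refine le_of_le_of_eq ?_ (h4 t).deriv.symm
  have a2 := hV2 (t • x)
  have a3 := hV3 (t • x)
  have a4 := hV4 (t • x)
  simp only [map_smul, ContinuousLinearMap.smul_apply, smul_eq_mul, Pi.sub_apply] at a2 a3 a4 ⊢
  generalize V (t • x) = a at *
  generalize fderiv ℝ V (t • x) x = b at *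
  generalize fderiv ℝ (fderiv ℝ V) (t • x) x x = c at *
  obtain ⟨n, rfl⟩ : ∃ n, N = n + 1 := ⟨N - 1, by omega⟩
  simp only [Nat.add_sub_cancel]
  generalize ((n + 1 : ℕ) : ℝ) = M at *
  have hM : 0 < M := hμ0.trans hμN
  have e : M * t ^ n * ((M - μ) * a - t * b) + t ^ (n + 1) * ((M - μ) * b - (t * c + b))
      = t ^ n * ((M - μ) * (M * a + t * b) - t * b - (M * (t * b) + t * (t * c))) := by
    ring
  rw [e]
  have h5 : 0 ≤ (M - μ) * (M * a + t * b) :=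
    mul_nonneg (by linarith) ((mul_pos hM hVinf).le.trans a3)
  exact mul_nonneg (pow_pos ht n).le (by linarith)
end
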